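/- arXiv:math/0111306 — 2 statements merged into one kernel-verified Lean document; each statement's English description precedes it below -/
import Mathlib

section
/- Let K be a field, let n ≥ 1 and m ≥ 0 be integers, and let A be an n×n matrix over K. Let φ_A be the K-algebra endomorphism of the polynomial ring K[X_1,…,X_n] determined by φ_A(X_j) = ∑_{i=1}^n A_{ij} X_i. Then φ_A restricts to a K-linear endomorphism of the space of homogeneous polynomials of degree m (the m-th symmetric power of the standard representation), and the determinant of this restriction equals (det A)^{C(n+m−1, n)}. -/
open MvPolynomial

section LinearSubstitution

variable {ι R : Type*} [Fintype ι] [CommRing R]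

/-- The substitution `X_j ↦ ∑_i A_{ij} X_i`. -/
noncomputable def linearSubst (A : Matrix ι ι R) : MvPolynomial ι R →ₐ[R] MvPolynomial ι R :=
  aeval fun j => ∑ i, A i j • X i

@[simp]
lemma linearSubst_X (A : Matrix ι ι R) (j : ι) :
    linearSubst A (X j) = ∑ i, A i j • X i := by
  simp [linearSubst]

lemma linearSubst_mul (A B : Matrix ι ι R) :
    linearSubst (A * B) = (linearSubst A).comp (linearSubst B) := by
  refine MvPolynomial.algHom_ext fun j => ?_
  simp only [linearSubst_X, AlgHom.comp_apply, map_sum, map_smul, Matrix.mul_apply,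
    Finset.sum_smul, Finset.smul_sum, smul_smul]
  rw [Finset.sum_comm]
  simp only [mul_comm]

lemma linearSubst_mem_homogeneousSubmodule (A : Matrix ι ι R) (m : ℕ) :
    ∀ p ∈ homogeneousSubmodule ι R m, linearSubst A p ∈ homogeneousSubmodule ι R m := by
  intro p hp
  rw [mem_homogeneousSubmodule] at hp ⊢
  have h := hp.aeval (fun j => ∑ i, A i j • (X i : MvPolynomial ι R)) (n := 1) fun j =>
    IsHomogeneous.sum _ _ _ fun i _ => by
      rw [smul_eq_C_mul]
      simpa using (isHomogeneous_C ι (A i j)).mul (isHomogeneous_X R i)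
  simpa [linearSubst] using h

/-- The endomorphism of the homogeneous polynomials of degree `m` induced by a matrix. -/
noncomputable def linearSubstHomogeneous (m : ℕ) (A : Matrix ι ι R) :
    homogeneousSubmodule ι R m →ₗ[R] homogeneousSubmodule ι R m :=
  (linearSubst A).toLinearMap.restrict (linearSubst_mem_homogeneousSubmodule A m)

@[simp]
lemma coe_linearSubstHomogeneous (m : ℕ) (A : Matrix ι ι R) (p : homogeneousSubmodule ι R m) :
    (linearSubstHomogeneous m A p : MvPolynomial ι R) = linearSubst A p := rfl

lemma linearSubstHomogeneous_mul (m : ℕ) (A B : Matrix ι ι R) :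
    linearSubstHomogeneous m (A * B) =
      linearSubstHomogeneous m A * linearSubstHomogeneous m B := by
  ext1 p
  apply Subtype.ext
  simp [linearSubst_mul]

omit [Fintype ι] in
variable (ι R) in
/-- The monomial basis of the homogeneous polynomials of degree `m`. -/
noncomputable def homogeneousBasis (m : ℕ) :
    Module.Basis {d : ι →₀ ℕ | d.degree = m} R (homogeneousSubmodule ι R m) :=
  (basisRestrictSupport R {d : ι →₀ ℕ | d.degree = m}).map
    (LinearEquiv.ofEq _ _ (homogeneousSubmodule_eq_finsupp_supported ι R m).symm)

omit [Fintype ι] in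
lemma homogeneousBasis_repr (m : ℕ) (p : homogeneousSubmodule ι R m)
    (d : {d : ι →₀ ℕ | d.degree = m}) :
    (homogeneousBasis ι R m).repr p d = coeff (d : ι →₀ ℕ) (p : MvPolynomial ι R) := rfl

omit [Fintype ι] in
lemma coe_homogeneousBasis (m : ℕ) (d : {d : ι →₀ ℕ | d.degree = m}) :
    (homogeneousBasis ι R m d : MvPolynomial ι R) = monomial (d : ι →₀ ℕ) 1 := by
  classical
  ext e
  by_cases he : e.degree = m
  · rw [← homogeneousBasis_repr m _ ⟨e, he⟩, Module.Basis.repr_self, coeff_monomial,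
      Finsupp.single_apply]
    simp [Subtype.ext_iff]
  · rw [coeff_monomial, if_neg (by rintro rfl; exact he d.2)]
    exact (homogeneousBasis ι R m d).2.coeff_eq_zero he

lemma finite_degree_eq (m : ℕ) : {d : ι →₀ ℕ | d.degree = m}.Finite :=
  (Finsupp.finite_of_degree_le m).subset fun _ h => le_of_eq h

noncomputable instance (m : ℕ) : Fintype {d : ι →₀ ℕ | d.degree = m} :=
  (finite_degree_eq m).fintype

lemma card_degree_eq (m : ℕ) :
    Fintype.card {d : ι →₀ ℕ | d.degree = m} = (Fintype.card ι + m - 1).choose m := by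
  classical
  rw [← Sym.card_sym_eq_choose]
  exact Fintype.card_congr (Sym.equivNatSum ι m).symm

lemma sum_exponent_eq_choose [Nonempty ι] (m : ℕ) (j : ι) :
    ∑ d : {d : ι →₀ ℕ | d.degree = m}, (d : ι →₀ ℕ) j =
      (Fintype.card ι + m - 1).choose (Fintype.card ι) := by
  classical
  have hsymm : ∀ i, ∑ d : {d : ι →₀ ℕ | d.degree = m}, (d : ι →₀ ℕ) i =
      ∑ d : {d : ι →₀ ℕ | d.degree = m}, (d : ι →₀ ℕ) j := by
    intro i
    refine Fintype.sum_equiv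
      ((Finsupp.domCongr (M := ℕ) (Equiv.swap i j)).toEquiv.subtypeEquiv fun d => ?_) _ _ fun d => ?_
    · simp [Finsupp.degree_eq_sum, Finsupp.equivMapDomain_apply,
        Equiv.sum_comp (Equiv.swap i j) d]
    · simp [Finsupp.equivMapDomain_apply]
  have htotal : ∑ i, ∑ d : {d : ι →₀ ℕ | d.degree = m}, (d : ι →₀ ℕ) i =
      (Fintype.card ι + m - 1).choose m * m := by
    rw [Finset.sum_comm, ← card_degree_eq, ← smul_eq_mul, ← Finset.card_univ,
      ← Finset.sum_const]
    refine Finset.sum_congr rfl fun d _ => ?_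
    rw [← Finsupp.degree_eq_sum]
    exact d.2
  simp only [hsymm, Finset.sum_const, Finset.card_univ, smul_eq_mul] at htotal
  obtain ⟨k, hk⟩ : ∃ k, Fintype.card ι = k + 1 := Nat.exists_eq_succ_of_ne_zero Fintype.card_ne_zero
  rw [hk] at htotal ⊢
  have h1 := Nat.choose_succ_right_eq (k + m) k
  have h2 : (k + m).choose m = (k + m).choose k := by
    rw [Nat.choose_symm_add]
  rw [show k + 1 + m - 1 = k + m by lia] at htotal ⊢
  rw [Nat.add_sub_cancel_left] at h1
  refine Nat.eq_of_mul_eq_mul_left (Nat.succ_pos k) ?_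
  rw [htotal, h2, ← h1, mul_comm]

lemma linearSubst_monomial (A : Matrix ι ι R) (d : ι →₀ ℕ) :
    linearSubst A (monomial d 1) = ∏ j, (∑ i, A i j • (X i : MvPolynomial ι R)) ^ d j := by
  rw [linearSubst, aeval_monomial, map_one, one_mul, Finsupp.prod_fintype _ _ (by simp)]

lemma toMatrix_linearSubstHomogeneous {m : ℕ} [DecidableEq {d : ι →₀ ℕ | d.degree = m}]
    (A : Matrix ι ι R)
    (e d : {d : ι →₀ ℕ | d.degree = m}) :
    LinearMap.toMatrix (homogeneousBasis ι R m) (homogeneousBasis ι R m)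
      (linearSubstHomogeneous m A) e d = coeff (e : ι →₀ ℕ) (linearSubst A (monomial d 1)) := by
  rw [LinearMap.toMatrix_apply, homogeneousBasis_repr, coe_linearSubstHomogeneous,
    coe_homogeneousBasis]

lemma linearSubst_diagonal_monomial [DecidableEq ι] (D : ι → R) (d : ι →₀ ℕ) :
    linearSubst (Matrix.diagonal D) (monomial d 1) = monomial d (∏ j, D j ^ d j) := by
  rw [linearSubst_monomial]
  simp only [Matrix.diagonal_apply, ite_smul, zero_smul, Finset.sum_ite_eq', Finset.mem_univ,
    if_true, smul_eq_C_mul, mul_pow, Finset.prod_mul_distrib]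
  rw [monomial_eq, Finsupp.prod_fintype _ _ (by simp)]
  simp

lemma det_linearSubstHomogeneous_diagonal [Nonempty ι] [DecidableEq ι] (m : ℕ) (D : ι → R) :
    LinearMap.det (linearSubstHomogeneous m (Matrix.diagonal D)) =
      (Matrix.diagonal D).det ^ (Fintype.card ι + m - 1).choose (Fintype.card ι) := by
  classical
  rw [← LinearMap.det_toMatrix (homogeneousBasis ι R m)]
  have h : LinearMap.toMatrix (homogeneousBasis ι R m) (homogeneousBasis ι R m)
      (linearSubstHomogeneous m (Matrix.diagonal D)) =
      Matrix.diagonal fun d : {d : ι →₀ ℕ | d.degree = m} => ∏ j, D j ^ (d : ι →₀ ℕ) j := by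
    ext e d
    rw [toMatrix_linearSubstHomogeneous, linearSubst_diagonal_monomial, coeff_monomial,
      Matrix.diagonal_apply]
    by_cases hed : e = d
    · simp [hed]
    · rw [if_neg hed, if_neg fun h => hed (Subtype.ext h.symm)]
  rw [h, Matrix.det_diagonal, Matrix.det_diagonal, Finset.prod_comm, ← Finset.prod_pow]
  refine Finset.prod_congr rfl fun j _ => ?_
  rw [Finset.prod_pow_eq_pow_sum, sum_exponent_eq_choose]

lemma linearSubst_transvection_X [DecidableEq ι] (i j k : ι) (c : R) :
    linearSubst (Matrix.transvection i j c) (X k) = X k + if k = j then C c * X i else 0 := by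
  rw [linearSubst_X]
  simp only [Matrix.transvection, Matrix.add_apply, add_smul, Finset.sum_add_distrib,
    Matrix.one_apply, Matrix.single_apply, ite_smul, one_smul, zero_smul]
  by_cases h : k = j
  · simp [h, smul_eq_C_mul]
  · simp [h, Ne.symm h]

/-- A transvection changes a monomial only by terms with a smaller exponent at `j`. -/
lemma exponent_lt_of_mem_support_linearSubst_transvection_sub [DecidableEq ι] {i j : ι}
    (hij : i ≠ j) (c : R) (d : ι →₀ ℕ) :
    ∀ e ∈ (linearSubst (Matrix.transvection i j c) (monomial d 1) - monomial d 1).support,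
      e j < d j := by
  set φ := linearSubst (Matrix.transvection i j c)
  have hmul : ∀ {p q : MvPolynomial ι R} {b l : ℕ}, (∀ e ∈ p.support, e j < b) →
      (∀ e ∈ q.support, e j ≤ l) → ∀ e ∈ (p * q).support, e j < b + l := by
    intro p q b l hp hq e he
    obtain ⟨u, hu, v, hv, rfl⟩ := Finset.mem_add.mp (support_mul p q he)
    have := hp u hu
    have := hq v hv
    rw [Finsupp.add_apply]
    lia
  have hmonomial : ∀ d : ι →₀ ℕ, ∀ e ∈ (monomial d (1 : R)).support, e j ≤ d j := by
    intro d e he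
    rw [Finset.mem_singleton.mp (support_monomial_subset he)]
  have hadd : ∀ d₁ d₂ : ι →₀ ℕ,
      (∀ e ∈ (φ (monomial d₁ 1) - monomial d₁ 1).support, e j < d₁ j) →
      (∀ e ∈ (φ (monomial d₂ 1) - monomial d₂ 1).support, e j < d₂ j) →
      ∀ e ∈ (φ (monomial (d₁ + d₂) 1) - monomial (d₁ + d₂) 1).support, e j < (d₁ + d₂) j := by
    intro d₁ d₂ h₁ h₂ e he
    have hsplit : φ (monomial (d₁ + d₂) 1) - monomial (d₁ + d₂) 1 =
        (φ (monomial d₁ 1) - monomial d₁ 1) * (φ (monomial d₂ 1) - monomial d₂ 1) +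
        (φ (monomial d₁ 1) - monomial d₁ 1) * monomial d₂ 1 +
        (φ (monomial d₂ 1) - monomial d₂ 1) * monomial d₁ 1 := by
      rw [← one_mul (1 : R), ← monomial_mul, map_mul, one_mul]
      ring
    rw [hsplit] at he
    rw [Finsupp.add_apply]
    rcases Finset.mem_union.mp (support_add he) with he | he
    · rcases Finset.mem_union.mp (support_add he) with he | he
      · exact hmul h₁ (fun e he => (h₂ e he).le) e he
      · exact hmul h₁ (hmonomial d₂) e he
    · rw [add_comm]
      exact hmul h₂ (hmonomial d₁) e he
  have hzero : ∀ e ∈ (φ (monomial 0 1) - monomial 0 1).support, e j < (0 : ι →₀ ℕ) j := by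
    intro e he
    rw [show (monomial 0 1 : MvPolynomial ι R) = 1 from rfl, map_one, sub_self] at he
    simp at he
  induction d using Finsupp.induction_linear with
  | zero => exact hzero
  | add d₁ d₂ h₁ h₂ => exact hadd d₁ d₂ h₁ h₂
  | single k l =>
    induction l with
    | zero => simpa only [Finsupp.single_zero] using hzero
    | succ l ih =>
      rw [Finsupp.single_add]
      refine hadd _ _ ih fun e he => ?_
      rw [show monomial (Finsupp.single k 1) 1 = (X k : MvPolynomial ι R) from rfl,
        linearSubst_transvection_X, add_sub_cancel_left] at he
      split_ifs at he with hk
      · subst hk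
        rw [C_mul_X_eq_monomial] at he
        rw [Finset.mem_singleton.mp (support_monomial_subset he)]
        simp [hij]
      · simp at he

lemma det_linearSubstHomogeneous_transvection [DecidableEq ι] (m : ℕ) {i j : ι}
    (hij : i ≠ j) (c : R) :
    LinearMap.det (linearSubstHomogeneous m (Matrix.transvection i j c)) = 1 := by
  classical
  rw [← LinearMap.det_toMatrix (homogeneousBasis ι R m)]
  have hcoeff : ∀ e d : {d : ι →₀ ℕ | d.degree = m}, (d : ι →₀ ℕ) j ≤ (e : ι →₀ ℕ) j →
      LinearMap.toMatrix (homogeneousBasis ι R m) (homogeneousBasis ι R m)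
        (linearSubstHomogeneous m (Matrix.transvection i j c)) e d =
        (1 : Matrix _ _ R) e d := by
    intro e d hed
    have h := mt (exponent_lt_of_mem_support_linearSubst_transvection_sub hij c d e) hed.not_gt
    rw [notMem_support_iff, coeff_sub, sub_eq_zero] at h
    rw [toMatrix_linearSubstHomogeneous, h, coeff_monomial, Matrix.one_apply]
    simp [Subtype.ext_iff, eq_comm]
  have htri : (LinearMap.toMatrix (homogeneousBasis ι R m) (homogeneousBasis ι R m)
      (linearSubstHomogeneous m (Matrix.transvection i j c))).BlockTriangular
      fun d => (d : ι →₀ ℕ) j := by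
    intro e d hed
    rw [hcoeff e d (le_of_lt hed), Matrix.one_apply_ne]
    rintro rfl
    exact lt_irrefl _ hed
  rw [htri.det]
  refine Finset.prod_eq_one fun a _ => ?_
  refine Eq.trans (congrArg Matrix.det ?_) Matrix.det_one
  ext e d
  rw [Matrix.toSquareBlock_def, Matrix.of_apply, hcoeff _ _ (by rw [e.2, d.2]), Matrix.one_apply,
    Matrix.one_apply]
  simp [Subtype.ext_iff]

theorem det_linearSubstHomogeneous {K : Type*} [Field K] [Nonempty ι] [DecidableEq ι] (m : ℕ)
    (A : Matrix ι ι K) :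
    LinearMap.det (linearSubstHomogeneous m A) =
      A.det ^ (Fintype.card ι + m - 1).choose (Fintype.card ι) := by
  induction A using Matrix.diagonal_transvection_induction with
  | hdiag D _ => exact det_linearSubstHomogeneous_diagonal m D
  | htransvec t =>
    rw [t.det, one_pow]
    exact det_linearSubstHomogeneous_transvection m t.hij t.c
  | hmul A B hA hB => rw [linearSubstHomogeneous_mul, map_mul, hA, hB, Matrix.det_mul, mul_pow]

end LinearSubstitution

/-- `det S^m(A) = (det A)^{C(n+m-1, n)}`: the algebra endomorphism of `K[X_1,…,X_n]` sending
`X_j ↦ ∑_i A_{ij} X_i` restricts to a linear endomorphism of the space of homogeneous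
polynomials of degree `m`, whose determinant is `(det A)^{C(n+m-1, n)}`. -/
theorem det_symmetricPower (K : Type*) [Field K] (n m : ℕ) (hn : 1 ≤ n)
    (A : Matrix (Fin n) (Fin n) K) :
    ∃ h : ∀ p ∈ MvPolynomial.homogeneousSubmodule (Fin n) K m,
        (MvPolynomial.aeval (fun j : Fin n => ∑ i : Fin n, A i j • MvPolynomial.X i) :
          MvPolynomial (Fin n) K →ₐ[K] MvPolynomial (Fin n) K) p ∈
          MvPolynomial.homogeneousSubmodule (Fin n) K m,
      LinearMap.det
        ((MvPolynomial.aeval (fun j : Fin n => ∑ i : Fin n, A i j • MvPolynomial.X i) :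
          MvPolynomial (Fin n) K →ₐ[K] MvPolynomial (Fin n) K).toLinearMap.restrict h)
        = A.det ^ ((n + m - 1).choose n) := by
  have : Nonempty (Fin n) := ⟨⟨0, hn⟩⟩
  refine ⟨linearSubst_mem_homogeneousSubmodule A m, ?_⟩
  have h := det_linearSubstHomogeneous m A
  rwa [Fintype.card_fin] at h
end

section
/- Let F be a field of characteristic zero, let I be a finite index set, and let B = F[y_n^{(i)} : n ≥ 1, i ∈ I] be the polynomial algebra in countably many variables y_n^{(i)}. For each n ≥ 1 let (c^{(n)}_{i,j})_{i,j ∈ I} be a matrix with entries in F, and set z_n^{(i)} = ∑_{j ∈ I} c^{(n)}_{i,j} y_n^{(j)}. Suppose (·,·)_S and (·,·)_K are F-bilinear forms on B satisfying, for all f, g ∈ B, all n ≥ 1 and all i ∈ I: (1, f)_S = (1, f)_K; (n·y_n^{(i)}·f, g)_K = (f, ∂g/∂y_n^{(i)})_K; and (n·y_n^{(i)}·f, g)_S = (f, ∑_{j ∈ I} c^{(n)}_{i,j} ∂g/∂y_n^{(j)})_S. Then for every h ≥ 0, all n_1,…,n_h ≥ 1, all i_1,…,i_h ∈ I and every f ∈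 B, one has (y_{n_1}^{(i_1)} ⋯ y_{n_h}^{(i_h)}, f)_S = (z_{n_1}^{(i_1)} ⋯ z_{n_h}^{(i_h)}, f)_K. -/
open MvPolynomial

/-- Lemma 5.2 in abstract form. Let `B = F[y_n^{(i)} : n ≥ 1, i ∈ I]` over a field `F` of
characteristic zero, with `I` finite, and set `z_n^{(i)} = ∑_j c^{(n)}_{i,j} y_n^{(j)}`.
If `(·,·)_S` and `(·,·)_K` are bilinear forms on `B` with `(1,f)_S = (1,f)_K`, the
`(·,·)_K`-adjoint of multiplication by `n·y_n^{(i)}` equal to `∂/∂y_n^{(i)}`, and the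
`(·,·)_S`-adjoint of multiplication by `n·y_n^{(i)}` equal to `∑_j c^{(n)}_{i,j} ∂/∂y_n^{(j)}`,
then `(y_{n_1}^{(i_1)} ⋯ y_{n_h}^{(i_h)}, f)_S = (z_{n_1}^{(i_1)} ⋯ z_{n_h}^{(i_h)}, f)_K`
for all monomials and all `f ∈ B`. -/
theorem shapovalov_contravariant_comparison
    (F : Type*) [Field F] [CharZero F] (I : Type*) [Fintype I]
    (c : ℕ+ → I → I → F)
    (S K : MvPolynomial (ℕ+ × I) F →ₗ[F] MvPolynomial (ℕ+ × I) F →ₗ[F] F)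
    (h1 : ∀ f, S 1 f = K 1 f)
    (hK : ∀ (f g : MvPolynomial (ℕ+ × I) F) (n : ℕ+) (i : I),
      K (((n : ℕ) : F) • (MvPolynomial.X (n, i) * f)) g
        = K f (MvPolynomial.pderiv (n, i) g))
    (hS : ∀ (f g : MvPolynomial (ℕ+ × I) F) (n : ℕ+) (i : I),
      S (((n : ℕ) : F) • (MvPolynomial.X (n, i) * f)) g
        = S f (∑ j : I, c n i j • MvPolynomial.pderiv (n, j) g)) :
    ∀ (h : ℕ) (ns : Fin h → ℕ+) (is : Fin h → I) (f : MvPolynomial (ℕ+ × I) F),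
      S (∏ t : Fin h, MvPolynomial.X (ns t, is t)) f
        = K (∏ t : Fin h, ∑ j : I, c (ns t) (is t) j • MvPolynomial.X (ns t, j)) f := by
  intro h
  induction h with
  | zero => intro ns is f; simpa using h1 f
  | succ h ih =>
    intro ns is f
    have hn : (((ns 0 : ℕ+) : ℕ) : F) ≠ 0 := Nat.cast_ne_zero.mpr (ns 0).ne_zero
    rw [Fin.prod_univ_succ, Fin.prod_univ_succ]
    apply mul_left_cancel₀ hn
    have hS' := hS (∏ t : Fin h, X (ns t.succ, is t.succ)) f (ns 0) (is 0)
    rw [ih (fun t => ns t.succ) (fun t => is t.succ)] at hS'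
    simp only [map_sum, map_smul, LinearMap.smul_apply, smul_eq_mul, ← hK] at hS'
    rw [hS', Finset.sum_mul, map_sum, LinearMap.sum_apply, Finset.mul_sum]
    refine Finset.sum_congr rfl fun j _ => ?_
    rw [smul_mul_assoc, map_smul, LinearMap.smul_apply, smul_eq_mul]
    ring
end
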